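/- arXiv:1504.01661 — 2 statements merged into one kernel-verified Lean document; each statement's English description precedes it below -/
import Mathlib

section
/- Let A ∈ ℂ^{N×P} with N > P have full column rank P, written in blocks A = [A₁; A₂] with A₁ ∈ ℂ^{P×P} invertible, and let Γ_s ∈ ℂ^{P×P} be invertible. Set G₁ = AΓ_sA₁^* ∈ ℂ^{N×P} (the first P columns of the noiseless covariance Γ = AΓ_sA^*) and G₂ = AΓ_sA₂^* ∈ ℂ^{N×(N−P)} (its last N−P columns). Then G₁^*G₁ is invertible and (G₁^*G₁)^{−1}G₁^*G₂ = (A₂A₁^{−1})^*, i.e., the pseudoinverse formula G₁^†G₂ recovers the conjugate transpose of the propagator Π = A₂A₁^{−1}. -/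
open Matrix

open scoped ComplexOrder in
/-- A complex matrix of full column rank has an invertible Gram matrix. -/
theorem Matrix.isUnit_conjTranspose_mul_self_of_rank_eq {m n : Type*} [Fintype m] [Fintype n]
    [DecidableEq n] (B : Matrix m n ℂ) (h : B.rank = Fintype.card n) : IsUnit (Bᴴ * B) := by
  refine (PosDef.conjTranspose_mul_self B ?_).isUnit
  rw [mulVec_injective_iff, linearIndependent_iff_card_eq_finrank_span, ← h,
    rank_eq_finrank_span_cols]
  rfl

/-- The pseudoinverse formula for the propagator: with `A = [A₁; A₂]` of full column
rank, `A₁` and `Γ_s` invertible, and `G₁ = AΓ_sA₁ᴴ`, `G₂ = AΓ_sA₂ᴴ` the first `P` and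
last `N−P` columns of the noiseless covariance `Γ = AΓ_sAᴴ`, the matrix `G₁ᴴG₁` is
invertible and `(G₁ᴴG₁)⁻¹G₁ᴴG₂ = (A₂A₁⁻¹)ᴴ`. -/
theorem propagator_pseudoinverse_formula (N P : ℕ) (hNP : P < N)
    (A₁ : Matrix (Fin P) (Fin P) ℂ) (A₂ : Matrix (Fin (N - P)) (Fin P) ℂ)
    (Γs : Matrix (Fin P) (Fin P) ℂ)
    (hrank : (Matrix.fromRows A₁ A₂).rank = P)
    (hA₁ : IsUnit A₁) (hΓs : IsUnit Γs) :
    IsUnit ((Matrix.fromRows A₁ A₂ * Γs * A₁ᴴ)ᴴ * (Matrix.fromRows A₁ A₂ * Γs * A₁ᴴ)) ∧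
    ((Matrix.fromRows A₁ A₂ * Γs * A₁ᴴ)ᴴ * (Matrix.fromRows A₁ A₂ * Γs * A₁ᴴ))⁻¹ *
        (Matrix.fromRows A₁ A₂ * Γs * A₁ᴴ)ᴴ * (Matrix.fromRows A₁ A₂ * Γs * A₂ᴴ) =
      (A₂ * A₁⁻¹)ᴴ := by
  have hA₁H : IsUnit A₁ᴴ := hA₁.star
  have hG : (fromRows A₁ A₂ * Γs * A₁ᴴ).rank = Fintype.card (Fin P) := by
    rw [rank_mul_eq_left_of_isUnit_det _ _ ((isUnit_iff_isUnit_det _).1 hA₁H),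
      rank_mul_eq_left_of_isUnit_det _ _ ((isUnit_iff_isUnit_det _).1 hΓs), hrank,
      Fintype.card_fin]
  have hGram := isUnit_conjTranspose_mul_self_of_rank_eq _ hG
  refine ⟨hGram, ?_⟩
  have hG₂ : fromRows A₁ A₂ * Γs * A₂ᴴ = fromRows A₁ A₂ * Γs * A₁ᴴ * (A₂ * A₁⁻¹)ᴴ := by
    rw [conjTranspose_mul, conjTranspose_nonsing_inv, Matrix.mul_assoc _ A₁ᴴ,
      mul_nonsing_inv_cancel_left _ _ ((isUnit_iff_isUnit_det _).1 hA₁H)]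
  rw [hG₂, Matrix.mul_assoc, ← Matrix.mul_assoc _ _ (A₂ * A₁⁻¹)ᴴ,
    nonsing_inv_mul_cancel_left _ _ ((isUnit_iff_isUnit_det _).1 hGram)]
end

section
/- Let N = n·P with n ≥ 3, let A ∈ ℂ^{N×P} have all blocks A_m = e_m^T A ∈ ℂ^{P×P} invertible (1 ≤ m ≤ n), let Γ_s ∈ ℂ^{P×P} be invertible, σ ≥ 0, and Γ = AΓ_sA^* + σ²I_N with blocks Γ_{ij} = e_i^T Γ e_j. Then for any pairwise distinct indices i, j, k in {1,…,n}, the block Γ_{jk} is invertible and Γ_{ik}Γ_{jk}^{−1} = A_iA_j^{−1}; in particular Γ_{ik}Γ_{jk}^{−1}A_j = A_i, exactly and independently of the noise power σ². -/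
open Matrix

/-- The `i`-th selection matrix `e_i ∈ ℂ^{(n·P)×P}`, with entry `(r,s)` equal to `1`
iff `r = i·P + s` (0-indexed version of `r = (i−1)P + s`). -/
def selMat (n P : ℕ) (i : Fin n) : Matrix (Fin (n * P)) (Fin P) ℂ :=
  Matrix.of fun r s => if (r : ℕ) = i * P + s then 1 else 0

/-- Selection matrices of distinct blocks have orthogonal columns. -/
theorem selMat_transpose_mul_selMat_of_ne {n P : ℕ} {i k : Fin n} (hik : i ≠ k) :
    (selMat n P i)ᵀ * selMat n P k = 0 := by
  ext s t
  simp only [Matrix.mul_apply, Matrix.transpose_apply, selMat, Matrix.of_apply, Matrix.zero_apply]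
  refine Finset.sum_eq_zero fun r _ => ?_
  by_cases hs : (r : ℕ) = i * P + s
  · by_cases ht : (r : ℕ) = k * P + t
    · have hP : 0 < P := s.pos
      have hi : (r : ℕ) / P = i := by
        rw [hs, mul_comm, Nat.mul_add_div hP, Nat.div_eq_of_lt s.isLt, add_zero]
      have hk : (r : ℕ) / P = k := by
        rw [ht, mul_comm, Nat.mul_add_div hP, Nat.div_eq_of_lt t.isLt, add_zero]
      exact absurd (Fin.ext (hi.symm.trans hk)) hik
    · rw [if_neg ht, mul_zero]
  · rw [if_neg hs, zero_mul]

/-- Selection matrices are real, so their conjugate transpose is their transpose. -/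
theorem selMat_conjTranspose (n P : ℕ) (i : Fin n) : (selMat n P i)ᴴ = (selMat n P i)ᵀ := by
  ext s r
  simp only [Matrix.conjTranspose_apply, Matrix.transpose_apply, selMat, Matrix.of_apply]
  split_ifs <;> simp

/-- The noise does not contribute to the off-diagonal blocks of the covariance. -/
theorem covariance_block_of_ne {n P : ℕ} (A : Matrix (Fin (n * P)) (Fin P) ℂ)
    (Γs : Matrix (Fin P) (Fin P) ℂ) (c : ℂ) {i k : Fin n} (hik : i ≠ k) :
    (selMat n P i)ᵀ * (A * Γs * Aᴴ + c • 1) * selMat n P k =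
      ((selMat n P i)ᵀ * A) * (Γs * ((selMat n P k)ᵀ * A)ᴴ) := by
  rw [← selMat_conjTranspose n P k, Matrix.conjTranspose_mul, Matrix.conjTranspose_conjTranspose,
    Matrix.mul_add, Matrix.add_mul, Matrix.mul_smul, Matrix.mul_one, Matrix.smul_mul,
    selMat_transpose_mul_selMat_of_ne hik, smul_zero, add_zero]
  simp only [Matrix.mul_assoc]

/-- For pairwise distinct indices `i, j, k`, the block `Γ_{jk}` of the noisy covariance
`Γ = AΓ_sAᴴ + σ²I` is invertible and `Γ_{ik}Γ_{jk}⁻¹ = A_iA_j⁻¹`; in particular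
`Γ_{ik}Γ_{jk}⁻¹A_j = A_i`, exactly and independently of the noise power `σ²`. -/
theorem partial_propagator_exact (n P : ℕ) (hn : 3 ≤ n) (hP : 1 ≤ P)
    (A : Matrix (Fin (n * P)) (Fin P) ℂ)
    (hA : ∀ m : Fin n, IsUnit ((selMat n P m)ᵀ * A))
    (Γs : Matrix (Fin P) (Fin P) ℂ) (hΓs : IsUnit Γs)
    (σ : ℝ) (hσ : 0 ≤ σ)
    (Γ : Matrix (Fin (n * P)) (Fin (n * P)) ℂ)
    (hΓ : Γ = A * Γs * Aᴴ + ((σ : ℂ) ^ 2) • 1)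
    (i j k : Fin n) (hij : i ≠ j) (hjk : j ≠ k) (hik : i ≠ k) :
    IsUnit ((selMat n P j)ᵀ * Γ * selMat n P k) ∧
    ((selMat n P i)ᵀ * Γ * selMat n P k) * ((selMat n P j)ᵀ * Γ * selMat n P k)⁻¹ =
      ((selMat n P i)ᵀ * A) * ((selMat n P j)ᵀ * A)⁻¹ ∧
    ((selMat n P i)ᵀ * Γ * selMat n P k) * ((selMat n P j)ᵀ * Γ * selMat n P k)⁻¹ *
        ((selMat n P j)ᵀ * A) = (selMat n P i)ᵀ * A := by
  have hB : IsUnit (Γs * ((selMat n P k)ᵀ * A)ᴴ) := hΓs.mul (hA k).star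
  have hprop : ((selMat n P i)ᵀ * Γ * selMat n P k) * ((selMat n P j)ᵀ * Γ * selMat n P k)⁻¹ =
      ((selMat n P i)ᵀ * A) * ((selMat n P j)ᵀ * A)⁻¹ := by
    rw [hΓ, covariance_block_of_ne A Γs _ hik, covariance_block_of_ne A Γs _ hjk,
      Matrix.mul_inv_rev, Matrix.mul_assoc, Matrix.mul_nonsing_inv_cancel_left _ _
        ((Matrix.isUnit_iff_isUnit_det _).mp hB)]
  refine ⟨?_, hprop, ?_⟩
  · rw [hΓ, covariance_block_of_ne A Γs _ hjk]
    exact (hA j).mul hB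
  · rw [hprop]
    exact Matrix.nonsing_inv_mul_cancel_right _ _ ((Matrix.isUnit_iff_isUnit_det _).mp (hA j))
end
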